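/- arXiv:2001.01758 — 2 statements merged into one kernel-verified Lean document; each statement's English description precedes it below -/
import Mathlib

section
/- Let K be the ideal of Q generated by the elements τ_i² − τ·ξ_{i+1} for all i ≥ 0, together with ξ₁⁴, ξ₂², the elements ξ_n for all n ≥ 3, and the elements τ_n for all n ≥ 4. Then K is a coideal for the motivic coproduct: ψ(K) ⊆ K ⊗ Q + Q ⊗ K, and the counit vanishes on K. (The quotient Q/K is the Hopf algebra quotient B_* = R[τ₀, τ₁, τ₂, τ₃, ξ₁, ξ₂]/(τ₀² − τξ₁, ξ₁⁴, τ₁² − τξ₂, ξ₂², τ₂², τ₃²) of the motivic dual Steenrod algebra.) -/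
open MvPolynomial TensorProduct

noncomputable section

/-- The motivic ground ring `R = F₂[τ]`. -/
abbrev R : Type := Polynomial (ZMod 2)

/-- The element `τ` of `R`. -/
def tR : R := Polynomial.X

/-- The polynomial `R`-algebra `Q = R[τ₀, τ₁, τ₂, …, ξ₁, ξ₂, …]`; the
variable `X (Sum.inl i)` represents `τᵢ`, and `X (Sum.inr n)` represents
`ξ_{n+1}`. -/
abbrev Q : Type := MvPolynomial (ℕ ⊕ ℕ) R

/-- The generator `τᵢ` of `Q`. -/
def tau (i : ℕ) : Q := X (Sum.inl i)

/-- The element `ξ_n` of `Q`, with the convention `ξ₀ = 1`. -/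
def xi : ℕ → Q
  | 0 => 1
  | n + 1 => X (Sum.inr n)

/-- The motivic coproduct `ψ : Q → Q ⊗ Q`, the unique `R`-algebra map with
`ψ(τᵢ) = τᵢ ⊗ 1 + Σ_{k=0}^{i} ξ_{i-k}^{2^k} ⊗ τ_k` and
`ψ(ξᵢ) = Σ_{k=0}^{i} ξ_{i-k}^{2^k} ⊗ ξ_k`. -/
def psi : Q →ₐ[R] Q ⊗[R] Q :=
  aeval fun g =>
    match g with
    | Sum.inl i =>
        (tau i) ⊗ₜ[R] (1 : Q) +
          ∑ k ∈ Finset.range (i + 1), ((xi (i - k)) ^ (2 ^ k)) ⊗ₜ[R] (tau k)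
    | Sum.inr n =>
        ∑ k ∈ Finset.range (n + 2), ((xi (n + 1 - k)) ^ (2 ^ k)) ⊗ₜ[R] (xi k)

/-- The counit `ε : Q → R`, the unique `R`-algebra map sending every
generator `τᵢ` and `ξᵢ` to `0`. -/
def eps : Q →ₐ[R] R :=
  aeval fun _ => 0

/-- The subspace `J ⊗ Q + Q ⊗ J` of `Q ⊗ Q` (equivalently, the ideal of
`Q ⊗ Q` generated by the images of `J` under the two inclusions). -/
def coidealSpan (J : Ideal Q) : Ideal (Q ⊗[R] Q) :=
  J.map (Algebra.TensorProduct.includeLeft : Q →ₐ[R] Q ⊗[R] Q) ⊔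
    J.map (Algebra.TensorProduct.includeRight : Q →ₐ[R] Q ⊗[R] Q)

/-- `A ⊗[R] A` (written so that the implicit module instances are the ones
derived from the algebra structure of `A`). -/
abbrev TSq (A : Type) [CommSemiring A] [Algebra R A] : Type := A ⊗[R] A

/-- The ideal `K` of `Q` generated by `τᵢ² - τ·ξ_{i+1}` for all `i ≥ 0`,
together with `ξ₁⁴`, `ξ₂²`, the `ξ_n` for `n ≥ 3`, and the `τ_n` for
`n ≥ 4`; the quotient `Q/K` is the Hopf algebra quotient
`B_* = R[τ₀, τ₁, τ₂, τ₃, ξ₁, ξ₂]/(τ₀² - τξ₁, ξ₁⁴, τ₁² - τξ₂, ξ₂², τ₂², τ₃²)`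
of the motivic dual Steenrod algebra. -/
def K : Ideal Q :=
  Ideal.span
    ({x | ∃ i, x = tau i ^ 2 - C tR * xi (i + 1)} ∪ {xi 1 ^ 4, xi 2 ^ 2} ∪
      {x | ∃ n, 3 ≤ n ∧ x = xi n} ∪ {x | ∃ n, 4 ≤ n ∧ x = tau n})

theorem xi_mem_K {n : ℕ} (hn : 3 ≤ n) : xi n ∈ K :=
  Ideal.subset_span (Or.inl (Or.inr ⟨n, hn, rfl⟩))

theorem tau_mem_K {n : ℕ} (hn : 4 ≤ n) : tau n ∈ K :=
  Ideal.subset_span (Or.inr ⟨n, hn, rfl⟩)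

theorem tau_sq_sub_mem_K (i : ℕ) : tau i ^ 2 - C tR * xi (i + 1) ∈ K :=
  Ideal.subset_span (Or.inl (Or.inl (Or.inl ⟨i, rfl⟩)))

theorem xi_one_pow_mem_K : xi 1 ^ 4 ∈ K :=
  Ideal.subset_span (Or.inl (Or.inl (Or.inr (Or.inl rfl))))

theorem xi_two_pow_mem_K : xi 2 ^ 2 ∈ K :=
  Ideal.subset_span (Or.inl (Or.inl (Or.inr (Or.inr rfl))))

theorem xi_pow_two_pow_mem_K {m k : ℕ} (hm : 1 ≤ m) (h : 3 ≤ m + k) :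
    xi m ^ 2 ^ k ∈ K := by
  obtain rfl | rfl | hm3 : m = 1 ∨ m = 2 ∨ 3 ≤ m := by omega
  · exact K.pow_mem_of_pow_mem xi_one_pow_mem_K
      (Nat.pow_le_pow_right two_pos (show 2 ≤ k by omega))
  · exact K.pow_mem_of_pow_mem xi_two_pow_mem_K
      (Nat.pow_le_pow_right two_pos (show 1 ≤ k by omega))
  · exact K.pow_mem_of_mem (xi_mem_K hm3) _ (by positivity)

theorem tmul_mem_coidealSpan_left {J : Ideal Q} {a : Q} (ha : a ∈ J) (b : Q) :
    a ⊗ₜ[R] b ∈ coidealSpan J := by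
  have h := Ideal.mul_mem_right ((1 : Q) ⊗ₜ[R] b) (coidealSpan J)
    (Ideal.mem_sup_left (Ideal.mem_map_of_mem
      (Algebra.TensorProduct.includeLeft : Q →ₐ[R] Q ⊗[R] Q) ha))
  simpa using h

theorem tmul_mem_coidealSpan_right {J : Ideal Q} (a : Q) {b : Q} (hb : b ∈ J) :
    a ⊗ₜ[R] b ∈ coidealSpan J := by
  have h := Ideal.mul_mem_left (coidealSpan J) (a ⊗ₜ[R] (1 : Q))
    (Ideal.mem_sup_right (Ideal.mem_map_of_mem
      (Algebra.TensorProduct.includeRight : Q →ₐ[R] Q ⊗[R] Q) hb))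
  simpa using h

theorem xi_zero : xi 0 = 1 := rfl

theorem psi_tau (i : ℕ) :
    psi (tau i) = tau i ⊗ₜ[R] (1 : Q) +
      ∑ k ∈ Finset.range (i + 1), (xi (i - k) ^ 2 ^ k) ⊗ₜ[R] tau k := by
  simp only [psi, tau, aeval_X]

theorem psi_xi (n : ℕ) :
    psi (xi n) = ∑ k ∈ Finset.range (n + 1), (xi (n - k) ^ 2 ^ k) ⊗ₜ[R] xi k := by
  cases n with
  | zero => simp [xi, Algebra.TensorProduct.one_def]
  | succ n =>
    conv_lhs => rw [xi, psi, aeval_X]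

instance charP_Q_tensor_Q : CharP (Q ⊗[R] Q) 2 := by
  have : Nontrivial (Q ⊗[R] Q) :=
    (Algebra.TensorProduct.lmul' R (S := Q)).toRingHom.domain_nontrivial
  refine CharTwo.of_one_ne_zero_of_two_eq_zero one_ne_zero ?_
  have h : (2 : R) = 0 := CharTwo.two_eq_zero
  rw [← map_ofNat (algebraMap R (Q ⊗[R] Q)) 2]
  exact (congrArg _ h).trans (map_zero _)

theorem psi_tau_sq_sub (i : ℕ) :
    psi (tau i ^ 2 - C tR * xi (i + 1)) =
      (tau i ^ 2 - C tR * xi (i + 1)) ⊗ₜ[R] (1 : Q) +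
        ∑ k ∈ Finset.range (i + 1),
          (xi (i - k) ^ 2 ^ (k + 1)) ⊗ₜ[R] (tau k ^ 2 - C tR * xi (k + 1)) := by
  have sum_sub (s : Finset ℕ) (f g : ℕ → Q ⊗[R] Q) :
      ∑ k ∈ s, (f k - g k) = ∑ k ∈ s, f k - ∑ k ∈ s, g k := Finset.sum_sub_distrib f g
  simp only [C_mul', map_sub, map_pow, map_smul, psi_tau, psi_xi, add_pow_char, sum_pow_char,
    Algebra.TensorProduct.tmul_pow, one_pow, ← pow_mul, ← pow_succ, TensorProduct.tmul_sub,
    TensorProduct.sub_tmul, TensorProduct.tmul_smul, ← TensorProduct.smul_tmul',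
    Finset.sum_range_succ' _ (i + 1), Nat.add_sub_add_right, smul_add,
    Finset.smul_sum, Nat.sub_zero, pow_zero, pow_one, xi_zero]
  rw [sum_sub]
  abel

theorem psi_tau_sq_sub_mem (i : ℕ) :
    psi (tau i ^ 2 - C tR * xi (i + 1)) ∈ coidealSpan K := by
  rw [psi_tau_sq_sub]
  exact add_mem (tmul_mem_coidealSpan_left (tau_sq_sub_mem_K i) _)
    (sum_mem fun k _ => tmul_mem_coidealSpan_right _ (tau_sq_sub_mem_K k))

theorem psi_xi_one_pow_mem : psi (xi 1 ^ 4) ∈ coidealSpan K := by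
  have h : psi (xi 1 ^ 4) = (xi 1 ^ 4) ⊗ₜ[R] (1 : Q) + (1 : Q) ⊗ₜ[R] (xi 1 ^ 4) := by
    rw [map_pow, psi_xi, show 4 = 2 ^ 2 from rfl, sum_pow_char_pow]
    simp [Finset.sum_range_succ, xi, Algebra.TensorProduct.tmul_pow]
  rw [h]
  exact add_mem (tmul_mem_coidealSpan_left xi_one_pow_mem_K _)
    (tmul_mem_coidealSpan_right _ xi_one_pow_mem_K)

theorem psi_xi_two_pow_mem : psi (xi 2 ^ 2) ∈ coidealSpan K := by
  have h : psi (xi 2 ^ 2) = (xi 2 ^ 2) ⊗ₜ[R] (1 : Q) + (xi 1 ^ 4) ⊗ₜ[R] (xi 1 ^ 2) +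
      (1 : Q) ⊗ₜ[R] (xi 2 ^ 2) := by
    rw [map_pow, psi_xi, sum_pow_char]
    simp [Finset.sum_range_succ, xi, Algebra.TensorProduct.tmul_pow, ← pow_mul]
  rw [h]
  exact add_mem (add_mem (tmul_mem_coidealSpan_left xi_two_pow_mem_K _)
    (tmul_mem_coidealSpan_left xi_one_pow_mem_K _))
    (tmul_mem_coidealSpan_right _ xi_two_pow_mem_K)

theorem psi_xi_mem {n : ℕ} (hn : 3 ≤ n) : psi (xi n) ∈ coidealSpan K := by
  rw [psi_xi]
  refine sum_mem fun k hk => ?_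
  rw [Finset.mem_range] at hk
  by_cases h : 3 ≤ k
  · exact tmul_mem_coidealSpan_right _ (xi_mem_K h)
  · exact tmul_mem_coidealSpan_left (xi_pow_two_pow_mem_K (by omega) (by omega)) _

theorem psi_tau_mem {n : ℕ} (hn : 4 ≤ n) : psi (tau n) ∈ coidealSpan K := by
  rw [psi_tau]
  refine add_mem (tmul_mem_coidealSpan_left (tau_mem_K hn) _) (sum_mem fun k hk => ?_)
  rw [Finset.mem_range] at hk
  by_cases h : 4 ≤ k
  · exact tmul_mem_coidealSpan_right _ (tau_mem_K h)
  · exact tmul_mem_coidealSpan_left (xi_pow_two_pow_mem_K (by omega) (by omega)) _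

theorem eps_tau (i : ℕ) : eps (tau i) = 0 := by
  simp [eps, tau]

theorem eps_xi {n : ℕ} (hn : n ≠ 0) : eps (xi n) = 0 := by
  obtain ⟨m, rfl⟩ := Nat.exists_eq_succ_of_ne_zero hn
  simp [eps, xi]

/-- The ideal `K` is a coideal for the motivic coproduct:
`ψ(K) ⊆ K ⊗ Q + Q ⊗ K`, and the counit `ε` vanishes on `K`. -/
theorem K_is_coideal :
    (∀ x ∈ K, psi x ∈ coidealSpan K) ∧ (∀ x ∈ K, eps x = 0) := by
  constructor
  · change K ≤ (coidealSpan K).comap psi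
    refine Ideal.span_le.2 ?_
    rintro x (((⟨i, rfl⟩ | rfl | rfl) | ⟨n, hn, rfl⟩) | ⟨n, hn, rfl⟩)
    · exact psi_tau_sq_sub_mem i
    · exact psi_xi_one_pow_mem
    · exact psi_xi_two_pow_mem
    · exact psi_xi_mem hn
    · exact psi_tau_mem hn
  · change K ≤ RingHom.ker eps
    refine Ideal.span_le.2 ?_
    rintro x (((⟨i, rfl⟩ | rfl | rfl) | ⟨n, hn, rfl⟩) | ⟨n, hn, rfl⟩)
    · simp [RingHom.mem_ker, eps_tau, eps_xi]
    · simp [RingHom.mem_ker, eps_xi]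
    · simp [RingHom.mem_ker, eps_xi]
    · exact eps_xi (by omega)
    · exact eps_tau n

end
end

section
/- Let S = F₂[X]/(X²) be the exterior algebra on one generator over F₂ = ℤ/2, and regard F₂ as an S-module via the S-algebra map sending X to 0. Then for every natural number n, the Ext group Ext_S^n(F₂, F₂) in the category of S-modules is a one-dimensional F₂-vector space (in particular it is nonzero for all n); i.e., the cohomology of an exterior algebra on one generator is a polynomial algebra on one generator. -/
open CategoryTheory

noncomputable section

abbrev F2 : Type := ZMod 2

/-- The exterior algebra `S = F₂[X]/(X²)` on one generator. -/
abbrev S : Type := Polynomial F2 ⧸ Ideal.span {(Polynomial.X : Polynomial F2) ^ 2}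

/-- The `S`-algebra map `S → F₂` sending `X` to `0`. -/
def toF2 : S →ₐ[F2] F2 :=
  Ideal.Quotient.liftₐ _ (Polynomial.aeval (0 : F2)) (by
    intro a ha
    obtain ⟨c, rfl⟩ := Ideal.mem_span_singleton.mp ha
    simp)

/-- `F₂` regarded as an `S`-module via the `S`-algebra map sending `X` to
`0`. -/
instance : Module S F2 := Module.compHom F2 toF2.toRingHom

/-- The endomorphism of `R` given by multiplication by an element of square zero. -/
def mulEnd {R : Type} [CommRing R] (x : R) : ModuleCat.of R R ⟶ ModuleCat.of R R :=
  ModuleCat.ofHom (LinearMap.mulLeft R x)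

lemma mulEnd_comp_self {R : Type} [CommRing R] {x : R} (hx : x * x = 0) :
    mulEnd x ≫ mulEnd x = 0 := by
  ext
  simp [mulEnd, hx]

/-- The periodic complex `⋯ ⟶ R ⟶ R ⟶ R` whose differentials are multiplication by an element of
square zero. -/
abbrev periodicComplex {R : Type} [CommRing R] {x : R} (hx : x * x = 0) :
    ChainComplex (ModuleCat R) ℕ :=
  HomologicalComplex.alternatingConst (ModuleCat.of R R) (mulEnd_comp_self hx)
    (mulEnd_comp_self hx) fun _ _ => ComplexShape.down_nat_odd_add

/-- The augmentation of the periodic complex given by a linear map killing `x`. -/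
def periodicComplexπ {R : Type} [CommRing R] {x : R} (hx : x * x = 0)
    {M : Type} [AddCommGroup M] [Module R M] (ε : R →ₗ[R] M) (hε : ε x = 0) :
    periodicComplex hx ⟶ (ChainComplex.single₀ (ModuleCat R)).obj (ModuleCat.of R M) :=
  ((periodicComplex hx).toSingle₀Equiv _).symm
    ⟨ModuleCat.ofHom ε, by ext; exact (congrArg ε (mul_one x)).trans hε⟩

lemma range_mulLeft_eq_ker {R : Type} [CommRing R] {x : R} (hx : x * x = 0)
    (hann : ∀ r, x * r = 0 → x ∣ r) :
    LinearMap.range (LinearMap.mulLeft R x) = LinearMap.ker (LinearMap.mulLeft R x) := by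
  ext r
  simp only [LinearMap.mem_range, LinearMap.mem_ker, LinearMap.mulLeft_apply]
  constructor
  · rintro ⟨s, rfl⟩
    rw [← mul_assoc, hx, zero_mul]
  · intro h
    obtain ⟨s, rfl⟩ := hann r h
    exact ⟨s, rfl⟩

lemma quasiIso_periodicComplexπ {R : Type} [CommRing R] {x : R} (hx : x * x = 0)
    (hann : ∀ r, x * r = 0 → x ∣ r) {M : Type} [AddCommGroup M] [Module R M] (ε : R →ₗ[R] M)
    (hε : ε x = 0) (hsurj : Function.Surjective ε) (hker : ∀ r, ε r = 0 → x ∣ r) :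
    QuasiIso (periodicComplexπ hx ε hε) where
  quasiIsoAt m := by
    induction m with
    | zero =>
      simp only [periodicComplexπ]
      rw [ChainComplex.quasiIsoAt₀_iff, ShortComplex.quasiIso_iff_of_zeros' _ rfl rfl rfl]
      constructor
      · rw [ShortComplex.moduleCat_exact_iff]
        intro r hr
        obtain ⟨s, rfl⟩ := hker r (by simpa [ChainComplex.toSingle₀Equiv] using! hr)
        exact ⟨s, by simp [mulEnd]; rfl⟩
      · rw [ModuleCat.epi_iff_surjective]
        simpa [ChainComplex.toSingle₀Equiv] using! hsurj
    | succ m _ =>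
      rw [quasiIsoAt_iff_exactAt' (hL := ChainComplex.exactAt_succ_single_obj ..),
          HomologicalComplex.exactAt_iff' _ (m + 2) (m + 1) m (by simp) (by simp),
          ShortComplex.moduleCat_exact_iff_range_eq_ker]
      simpa [mulEnd] using! range_mulLeft_eq_ker hx hann

/-- The periodic resolution of `M = R / x` when the annihilator of `x` is generated by `x`. -/
def periodicResolution {R : Type} [CommRing R] {x : R} (hx : x * x = 0)
    (hann : ∀ r, x * r = 0 → x ∣ r) {M : Type} [AddCommGroup M] [Module R M] (ε : R →ₗ[R] M)
    (hε : ε x = 0) (hsurj : Function.Surjective ε) (hker : ∀ r, ε r = 0 → x ∣ r) :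
    ProjectiveResolution (ModuleCat.of R M) where
  complex := periodicComplex hx
  projective _ := inferInstanceAs <| Projective (ModuleCat.of R R)
  π := periodicComplexπ hx ε hε
  quasiIso := quasiIso_periodicComplexπ hx hann ε hε hsurj hker

lemma linearYonedaObj_periodicComplex_d {R : Type} [CommRing R] {x : R} (hx : x * x = 0)
    {N : Type} [AddCommGroup N] [Module R N] (hN : ∀ y : N, x • y = 0) (i j : ℕ) :
    ((periodicComplex hx).linearYonedaObj R (ModuleCat.of R N)).d i j = 0 := by
  have h (f : ModuleCat.of R R ⟶ ModuleCat.of R N) : mulEnd x ≫ f = 0 := by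
    ext
    have := f.hom.map_smul x 1
    rw [hN] at this
    simpa [mulEnd] using! this
  ext f : 2
  change (periodicComplex hx).d j i ≫ f = 0
  by_cases hij : (ComplexShape.down ℕ).Rel j i
  · simpa [(show i + 1 = j from hij)] using! h f
  · rw [HomologicalComplex.shape _ _ _ hij]
    exact Limits.zero_comp

/-- The homology of a complex with vanishing differentials. -/
def homologyIsoX {C : Type*} [Category* C] [Abelian C] {ι : Type*} {c : ComplexShape ι}
    (K : HomologicalComplex C c) (hK : ∀ i j, K.d i j = 0) (i : ι) : K.homology i ≅ K.X i :=
  (K.isoHomologyπ _ i rfl (hK _ _)).symm ≪≫ K.iCyclesIso i _ rfl (hK _ _)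

/-- If the annihilator of `x` is generated by `x` and `x` acts as zero on `N`, then every
`Ext` group from `R / x` to `N` is isomorphic to `N`. -/
def extAddEquiv {R : Type} [CommRing R] {x : R} (hx : x * x = 0)
    (hann : ∀ r, x * r = 0 → x ∣ r) {M : Type} [AddCommGroup M] [Module R M] (ε : R →ₗ[R] M)
    (hε : ε x = 0) (hsurj : Function.Surjective ε) (hker : ∀ r, ε r = 0 → x ∣ r)
    {N : Type} [AddCommGroup N] [Module R N] (hN : ∀ y : N, x • y = 0) (n : ℕ) :
    (((Ext R (ModuleCat R) n).obj (Opposite.op (ModuleCat.of R M))).obj (ModuleCat.of R N)) ≃+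
      N :=
  ((((periodicResolution hx hann ε hε hsurj hker).isoExt n (ModuleCat.of R N)).trans
    (homologyIsoX _ (linearYonedaObj_periodicComplex_d hx hN) n)).toLinearEquiv.toAddEquiv.trans
    (ModuleCat.homAddEquiv (M := ModuleCat.of R R) (N := ModuleCat.of R N))).trans
    (LinearMap.ringLmapEquivSelf R R N).toAddEquiv

/-- The class of `X` in `S`. -/
def genS : S := Ideal.Quotient.mk _ Polynomial.X

lemma genS_mul_self : genS * genS = 0 := by
  rw [genS, ← map_mul, ← pow_two]
  exact Ideal.Quotient.eq_zero_iff_mem.mpr (Ideal.mem_span_singleton_self _)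

lemma genS_dvd_of_genS_mul_eq_zero (r : S) (h : genS * r = 0) : genS ∣ r := by
  obtain ⟨p, rfl⟩ := Ideal.Quotient.mk_surjective r
  rw [genS, ← map_mul, Ideal.Quotient.eq_zero_iff_mem, Ideal.mem_span_singleton, pow_two] at h
  exact map_dvd _ ((mul_dvd_mul_iff_left Polynomial.X_ne_zero).mp h)

lemma toF2_mk (p : Polynomial F2) : toF2 (Ideal.Quotient.mk _ p) = p.coeff 0 := by
  rw [Polynomial.coeff_zero_eq_aeval_zero]
  rfl

lemma toF2_genS : toF2 genS = 0 := by
  simp [genS, toF2_mk]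

lemma genS_dvd_of_toF2_eq_zero (r : S) (h : toF2 r = 0) : genS ∣ r := by
  obtain ⟨p, rfl⟩ := Ideal.Quotient.mk_surjective r
  rw [toF2_mk] at h
  exact map_dvd _ (Polynomial.X_dvd_iff.mpr h)

/-- The augmentation `S → F₂` as an `S`-linear map. -/
def augmentation : S →ₗ[S] F2 where
  toFun := toF2
  map_add' := map_add toF2
  map_smul' := map_mul toF2

lemma toF2_surjective : Function.Surjective toF2 := fun a =>
  ⟨algebraMap F2 S a, toF2.commutes a⟩

/-- For every `n`, the Ext group `Ext_S^n(F₂, F₂)` in the category of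
`S`-modules is a one-dimensional `F₂`-vector space, i.e. its underlying
additive group is isomorphic to `F₂ = ℤ/2`; in particular it is nonzero for
all `n`.  (The cohomology of an exterior algebra on one generator is a
polynomial algebra on one generator.) -/
theorem ext_of_exterior_algebra_is_polynomial (n : ℕ) :
    Nonempty
      ((((Ext S (ModuleCat S) n).obj
            (Opposite.op (ModuleCat.of S F2))).obj (ModuleCat.of S F2)) ≃+ F2) :=
  ⟨extAddEquiv genS_mul_self genS_dvd_of_genS_mul_eq_zero augmentation toF2_genS toF2_surjective
    genS_dvd_of_toF2_eq_zero
    (fun y => (congrArg (· * y) toF2_genS).trans (zero_mul y)) n⟩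

end
end
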